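/- Let G = (V, E) be a finite connected undirected graph with neighbor sets B_v, and V_a ⊆ V. For each v ∈ V let X_v ∈ ℝ^{N_v×(p+1)} and let Y_v be the N_v×N_v diagonal matrix of labels y_{vn} ∈ {−1, +1}. Let R = { ({r_v}, {ξ_v}) : Y_v X_v r_v ≥ 1_v − ξ_v and ξ_v ≥ 0 componentwise for all v ∈ V, and r_v = r_u for all v ∈ V and u ∈ B_v }, and let D = ∏_{v∈V_a} U_{v0} with U_{v0} = {δ ∈ ℝ^p : ‖δ‖₂² ≤ C_{v,δ}}, C_{v,δ} > 0. With B > 0, A > 0, C_a ≥ 0, define K'({r_v}, {ξ_v}, {δ_v}) = (1/2) Σ_{v∈V} r_vᵀ Π_{p+1} r_v + B Σ_{v∈V} 1ᵀ ξ_v + Σ_{v∈V_a} ( A r_vᵀ Îᵀ δ_v − C_a ‖δ_v‖₁ ). Then inf over ({r_v},{ξ_v}) ∈ R of sup over {δ_v} ∈ D of K' equals sup over {δ_v} ∈ D of inf over ({r_v},{ξ_v}) ∈ R of K', and there exists a saddle point ( ({r_v*},{ξ_v*}), {δ_v*} ) ∈ R × D of K'. -/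

import Mathlib

open Finset

lemma minimax_eq_maximin_of_saddle {E F : Type*} {R : Set E} {D : Set F} {f : E → F → ℝ}
    {a : E} {b : F} (ha : a ∈ R) (hb : b ∈ D)
    (hmax : ∀ y ∈ D, f a y ≤ f a b) (hmin : ∀ x ∈ R, f a b ≤ f x b)
    (habove : ∀ x ∈ R, BddAbove ((fun y => f x y) '' D))
    (hbelow : ∀ y ∈ D, BddBelow ((fun x => f x y) '' R)) :
    sInf ((fun x => sSup ((fun y => f x y) '' D)) '' R)
      = sSup ((fun y => sInf ((fun x => f x y) '' R)) '' D) := by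
  have hl : IsLeast ((fun x => sSup ((fun y => f x y) '' D)) '' R) (f a b) := by
    refine ⟨⟨a, ha, ?_⟩, ?_⟩
    · have : IsGreatest ((fun y => f a y) '' D) (f a b) :=
        ⟨⟨b, hb, rfl⟩, by rintro _ ⟨y, hy, rfl⟩; exact hmax y hy⟩
      exact this.csSup_eq
    · rintro _ ⟨x, hx, rfl⟩
      exact (hmin x hx).trans (le_csSup (habove x hx) ⟨b, hb, rfl⟩)
  have hg : IsGreatest ((fun y => sInf ((fun x => f x y) '' R)) '' D) (f a b) := by
    refine ⟨⟨b, hb, ?_⟩, ?_⟩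
    · have : IsLeast ((fun x => f x b) '' R) (f a b) :=
        ⟨⟨a, ha, rfl⟩, by rintro _ ⟨x, hx, rfl⟩; exact hmin x hx⟩
      exact this.csInf_eq
    · rintro _ ⟨y, hy, rfl⟩
      exact (csInf_le (hbelow y hy) ⟨a, ha, rfl⟩).trans (hmax y hy)
  rw [hl.csInf_eq, hg.csSup_eq]

/-- Minimax theorem on a possibly noncompact set `R`, when a compact convex subset `R₀` of `R`
dominates `R` for the minimizing player. -/
lemma minimax_of_dominating_compact {E F : Type*}
    [TopologicalSpace E] [AddCommGroup E] [Module ℝ E] [IsTopologicalAddGroup E]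
    [ContinuousSMul ℝ E]
    [TopologicalSpace F] [AddCommGroup F] [Module ℝ F] [IsTopologicalAddGroup F]
    [ContinuousSMul ℝ F]
    {R R₀ : Set E} {D : Set F} {f : E → F → ℝ} (hsub : R₀ ⊆ R)
    (hne : R₀.Nonempty) (hcpt : IsCompact R₀) (hconv : Convex ℝ R₀)
    (hDne : D.Nonempty) (hDcpt : IsCompact D) (hDconv : Convex ℝ D)
    (hleft : ∀ y, Continuous fun x => f x y) (hright : ∀ x, Continuous fun y => f x y)
    (hcvx : ∀ y, ConvexOn ℝ Set.univ fun x => f x y)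
    (hccv : ∀ x, ConcaveOn ℝ Set.univ fun y => f x y)
    (hdom : ∀ x ∈ R, ∀ y ∈ D, ∃ x' ∈ R₀, f x' y ≤ f x y) :
    sInf ((fun x => sSup ((fun y => f x y) '' D)) '' R)
      = sSup ((fun y => sInf ((fun x => f x y) '' R)) '' D) ∧
    ∃ a ∈ R, ∃ b ∈ D, (∀ y ∈ D, f a y ≤ f a b) ∧ (∀ x ∈ R, f a b ≤ f x b) := by
  obtain ⟨a, ha, b, hb, hab⟩ := Sion.exists_isSaddlePointOn' (f := f) hne hcpt
    (fun y _ => (hleft y).lowerSemicontinuous.lowerSemicontinuousOn _)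
    (fun y _ => ((hcvx y).subset (Set.subset_univ _) hconv).quasiconvexOn)
    hDconv hDcpt
    (fun x _ => (hright x).upperSemicontinuous.upperSemicontinuousOn _)
    (fun x _ => ((hccv x).subset (Set.subset_univ _) hDconv).quasiconcaveOn)
    hconv hDne
  have hmin : ∀ x ∈ R, f a b ≤ f x b := fun x hx => by
    obtain ⟨x', hx', hle⟩ := hdom x hx b hb
    exact (hab x' hx' b hb).trans hle
  refine ⟨minimax_eq_maximin_of_saddle (hsub ha) hb (hab a ha) hmin
    (fun x _ => (hDcpt.image (hright x)).bddAbove) (fun y hy => ?_),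
    a, hsub ha, b, hb, hab a ha, hmin⟩
  obtain ⟨m, hm⟩ := (hcpt.image (hleft y)).bddBelow
  refine ⟨m, ?_⟩
  rintro _ ⟨x, hx, rfl⟩
  obtain ⟨x', hx', hle⟩ := hdom x hx y hy
  exact (hm ⟨x', hx', rfl⟩).trans hle

/-- Clamping `t` to `[-M, M]` preserves the inequality `s ≤ a + c * t` when `s ≤ 1` and `M` is
large. -/
lemma le_add_mul_clamp {a c t s M : ℝ} (hst : s ≤ a + c * t) (hs : s ≤ 1)
    (hM0 : 0 ≤ M) (hM : (1 + |a|) / |c| ≤ M) :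
    s ≤ a + c * max (-M) (min M t) := by
  rcases eq_or_ne c 0 with rfl | hc
  · simpa using hst
  rw [div_le_iff₀ (abs_pos.2 hc)] at hM
  have ha := neg_abs_le a
  rcases le_total M t with h | h
  · rw [min_eq_left h, max_eq_right (by linarith)]
    rcases lt_or_gt_of_ne hc with h0 | h0
    · nlinarith
    · rw [abs_of_pos h0] at hM; nlinarith
  · rw [min_eq_right h]
    rcases le_total t (-M) with h' | h'
    · rw [max_eq_left h']
      rcases lt_or_gt_of_ne hc with h0 | h0
      · rw [abs_of_neg h0] at hM; nlinarith
      · nlinarith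
    · rwa [max_eq_right h']

section Game

variable {V : Type*} {p : ℕ} {N : V → ℕ}

/-- The objective `K'` of the game between the learner and the attacker. -/
noncomputable def gameObjective [Fintype V] (Va : Finset V) (B A Ca : ℝ)
    (x : (V → Fin (p + 1) → ℝ) × (∀ v : V, Fin (N v) → ℝ))
    (δ : {v : V // v ∈ Va} → Fin p → ℝ) : ℝ :=
  (1 / 2) * ∑ v : V, ∑ j : Fin p, (x.1 v j.castSucc) ^ 2
    + B * ∑ v : V, ∑ n : Fin (N v), x.2 v n
    + ∑ v : {v : V // v ∈ Va},
        (A * ∑ j : Fin p, x.1 (v : V) j.castSucc * δ v j - Ca * ∑ j : Fin p, |δ v j|)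

/-- The feasible set of the learner. -/
def learnerSet (G : SimpleGraph V) (X : ∀ v : V, Fin (N v) → Fin (p + 1) → ℝ)
    (y : ∀ v : V, Fin (N v) → ℝ) : Set ((V → Fin (p + 1) → ℝ) × (∀ v : V, Fin (N v) → ℝ)) :=
  {x | (∀ (v : V) (n : Fin (N v)),
          1 - x.2 v n ≤ y v n * ∑ i : Fin (p + 1), X v n i * x.1 v i) ∧
        (∀ (v : V) (n : Fin (N v)), 0 ≤ x.2 v n) ∧
        (∀ v u : V, G.Adj v u → x.1 v = x.1 u)}

/-- The feasible set of the attacker. -/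
def attackerSet (Va : Finset V) (p : ℕ) (Cδ : V → ℝ) : Set ({v : V // v ∈ Va} → Fin p → ℝ) :=
  {δ | ∀ v : {v : V // v ∈ Va}, ∑ j : Fin p, (δ v j) ^ 2 ≤ Cδ (v : V)}

lemma convexOn_gameObjective [Fintype V] (Va : Finset V) (B A Ca : ℝ) (δ : {v : V // v ∈ Va} → Fin p → ℝ) :
    ConvexOn ℝ Set.univ fun x => gameObjective (N := N) Va B A Ca x δ := by
  refine ⟨convex_univ, fun x _ z _ a b ha hb hab => ?_⟩
  have hsq : ∑ v : V, ∑ j : Fin p, (a * x.1 v j.castSucc + b * z.1 v j.castSucc) ^ 2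
      ≤ a * ∑ v : V, ∑ j : Fin p, (x.1 v j.castSucc) ^ 2
        + b * ∑ v : V, ∑ j : Fin p, (z.1 v j.castSucc) ^ 2 := by
    simp only [mul_sum, ← sum_add_distrib]
    refine sum_le_sum fun v _ => sum_le_sum fun j _ => ?_
    obtain rfl : b = 1 - a := by linarith
    nlinarith [mul_nonneg (mul_nonneg ha hb) (sq_nonneg (x.1 v j.castSucc - z.1 v j.castSucc))]
  have hlin : ∑ v : V, ∑ n : Fin (N v), (a * x.2 v n + b * z.2 v n)
      = a * ∑ v : V, ∑ n : Fin (N v), x.2 v n + b * ∑ v : V, ∑ n : Fin (N v), z.2 v n := by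
    simp only [mul_sum, ← sum_add_distrib]
  have hbil : ∑ v : {v : V // v ∈ Va},
        (A * ∑ j : Fin p, (a * x.1 (v : V) j.castSucc + b * z.1 (v : V) j.castSucc) * δ v j
          - Ca * ∑ j : Fin p, |δ v j|)
      = a * ∑ v : {v : V // v ∈ Va},
          (A * ∑ j : Fin p, x.1 (v : V) j.castSucc * δ v j - Ca * ∑ j : Fin p, |δ v j|)
        + b * ∑ v : {v : V // v ∈ Va},
          (A * ∑ j : Fin p, z.1 (v : V) j.castSucc * δ v j - Ca * ∑ j : Fin p, |δ v j|) := by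
    obtain rfl : b = 1 - a := by linarith
    rw [mul_sum, mul_sum, ← sum_add_distrib]
    refine sum_congr rfl fun v _ => ?_
    simp only [mul_sum, ← sum_add_distrib, ← sum_sub_distrib]
    exact sum_congr rfl fun j _ => by ring
  simp only [gameObjective, Prod.fst_add, Prod.snd_add, Prod.smul_fst, Prod.smul_snd,
    Pi.add_apply, Pi.smul_apply, smul_eq_mul]
  rw [hlin, hbil]
  linarith

lemma concaveOn_gameObjective [Fintype V] (Va : Finset V) (B A : ℝ) {Ca : ℝ} (hCa : 0 ≤ Ca)
    (x : (V → Fin (p + 1) → ℝ) × (∀ v : V, Fin (N v) → ℝ)) :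
    ConcaveOn ℝ Set.univ fun δ => gameObjective Va B A Ca x δ := by
  refine ⟨convex_univ, fun δ _ ε _ a b ha hb hab => ?_⟩
  have hsum : a * ∑ v : {v : V // v ∈ Va},
          (A * ∑ j : Fin p, x.1 (v : V) j.castSucc * δ v j - Ca * ∑ j : Fin p, |δ v j|)
        + b * ∑ v : {v : V // v ∈ Va},
          (A * ∑ j : Fin p, x.1 (v : V) j.castSucc * ε v j - Ca * ∑ j : Fin p, |ε v j|)
      ≤ ∑ v : {v : V // v ∈ Va},
        (A * ∑ j : Fin p, x.1 (v : V) j.castSucc * (a * δ v j + b * ε v j)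
          - Ca * ∑ j : Fin p, |a * δ v j + b * ε v j|) := by
    rw [mul_sum, mul_sum, ← sum_add_distrib]
    refine sum_le_sum fun v _ => ?_
    simp only [mul_sum, ← sum_add_distrib, ← sum_sub_distrib]
    refine sum_le_sum fun j _ => ?_
    have h := abs_add_le (a * δ v j) (b * ε v j)
    rw [abs_mul, abs_mul, abs_of_nonneg ha, abs_of_nonneg hb] at h
    nlinarith [mul_le_mul_of_nonneg_left h hCa]
  simp only [gameObjective, Pi.add_apply, Pi.smul_apply, smul_eq_mul]
  obtain rfl : b = 1 - a := by linarith
  linarith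

lemma continuous_gameObjective_left [Fintype V] (Va : Finset V) (B A Ca : ℝ)
    (δ : {v : V // v ∈ Va} → Fin p → ℝ) :
    Continuous fun x => gameObjective (N := N) Va B A Ca x δ := by
  unfold gameObjective
  fun_prop

lemma continuous_gameObjective_right [Fintype V] (Va : Finset V) (B A Ca : ℝ)
    (x : (V → Fin (p + 1) → ℝ) × (∀ v : V, Fin (N v) → ℝ)) :
    Continuous fun δ => gameObjective Va B A Ca x δ := by
  unfold gameObjective
  fun_prop

lemma convex_learnerSet (G : SimpleGraph V) (X : ∀ v : V, Fin (N v) → Fin (p + 1) → ℝ)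
    (y : ∀ v : V, Fin (N v) → ℝ) : Convex ℝ (learnerSet G X y) := by
  rintro x ⟨hx1, hx2, hx3⟩ z ⟨hz1, hz2, hz3⟩ a b ha hb hab
  refine ⟨fun v n => ?_, fun v n => ?_, fun v u h => ?_⟩
  · have hlin : ∑ i : Fin (p + 1), X v n i * (a * x.1 v i + b * z.1 v i)
        = a * ∑ i : Fin (p + 1), X v n i * x.1 v i
          + b * ∑ i : Fin (p + 1), X v n i * z.1 v i := by
      simp only [mul_sum, ← sum_add_distrib]
      exact sum_congr rfl fun i _ => by ring
    simp only [Prod.fst_add, Prod.snd_add, Prod.smul_fst, Prod.smul_snd,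
      Pi.add_apply, Pi.smul_apply, smul_eq_mul]
    rw [hlin]
    obtain rfl : b = 1 - a := by linarith
    linarith [mul_le_mul_of_nonneg_left (hx1 v n) ha, mul_le_mul_of_nonneg_left (hz1 v n) hb]
  · exact add_nonneg (mul_nonneg ha (hx2 v n)) (mul_nonneg hb (hz2 v n))
  · simp only [Prod.fst_add, Prod.smul_fst, Pi.add_apply, Pi.smul_apply, hx3 v u h, hz3 v u h]

lemma isClosed_learnerSet (G : SimpleGraph V) (X : ∀ v : V, Fin (N v) → Fin (p + 1) → ℝ)
    (y : ∀ v : V, Fin (N v) → ℝ) : IsClosed (learnerSet G X y) := by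
  simp only [learnerSet, Set.ofPred_and, Set.ofPred_forall]
  refine .inter (isClosed_iInter fun v => isClosed_iInter fun n => ?_)
    (.inter (isClosed_iInter fun v => isClosed_iInter fun n => ?_)
      (isClosed_iInter fun v => isClosed_iInter fun u => isClosed_iInter fun _ => ?_))
  · exact isClosed_le (by fun_prop) (by fun_prop)
  · exact isClosed_le (by fun_prop) (by fun_prop)
  · exact isClosed_eq (by fun_prop) (by fun_prop)

lemma convex_attackerSet (Va : Finset V) (Cδ : V → ℝ) : Convex ℝ (attackerSet Va p Cδ) := by
  intro δ hδ ε hε a b ha hb hab v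
  have hsq : ∑ j : Fin p, (a * δ v j + b * ε v j) ^ 2
      ≤ a * ∑ j : Fin p, (δ v j) ^ 2 + b * ∑ j : Fin p, (ε v j) ^ 2 := by
    simp only [mul_sum, ← sum_add_distrib]
    refine sum_le_sum fun j _ => ?_
    obtain rfl : b = 1 - a := by linarith
    nlinarith [mul_nonneg (mul_nonneg ha hb) (sq_nonneg (δ v j - ε v j))]
  simp only [Pi.add_apply, Pi.smul_apply, smul_eq_mul]
  refine hsq.trans ?_
  obtain rfl : b = 1 - a := by linarith
  linarith [mul_le_mul_of_nonneg_left (hδ v) ha, mul_le_mul_of_nonneg_left (hε v) hb]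

lemma attackerSet_nonempty (Va : Finset V) {Cδ : V → ℝ} (hCδ : ∀ v, 0 < Cδ v) :
    (attackerSet Va p Cδ).Nonempty := by
  refine ⟨0, ?_⟩
  simp only [attackerSet, Set.mem_ofPred_eq]
  intro v
  simp [(hCδ v).le]

lemma isCompact_attackerSet [Fintype V] (Va : Finset V) {Cδ : V → ℝ} (hCδ : ∀ v, 0 < Cδ v) :
    IsCompact (attackerSet Va p Cδ) := by
  have hclosed : IsClosed (attackerSet Va p Cδ) := by
    simp only [attackerSet, Set.ofPred_forall]
    exact isClosed_iInter fun v => isClosed_le (by fun_prop) (by fun_prop)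
  have hS : ∀ v, Cδ v ≤ ∑ u, Cδ u := fun v =>
    single_le_sum (fun u _ => (hCδ u).le) (mem_univ v)
  refine (isCompact_closedBall 0 (1 + ∑ u, Cδ u)).of_isClosed_subset hclosed fun δ hδ => ?_
  have hS0 : 0 ≤ ∑ u, Cδ u := sum_nonneg fun u _ => (hCδ u).le
  rw [mem_closedBall_zero_iff, pi_norm_le_iff_of_nonneg (by linarith)]
  intro v
  rw [pi_norm_le_iff_of_nonneg (by linarith)]
  intro j
  rw [Real.norm_eq_abs]
  have h1 : (δ v j) ^ 2 ≤ ∑ j : Fin p, (δ v j) ^ 2 :=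
    single_le_sum (f := fun j => (δ v j) ^ 2) (fun j _ => sq_nonneg _) (mem_univ j)
  refine abs_le_of_sq_le_sq (by nlinarith [hδ v, hS v]) (by linarith)

/-- Replace the bias by its clamp to `[-M, M]`. -/
noncomputable def clampBias (M : ℝ) (r : Fin (p + 1) → ℝ) : Fin (p + 1) → ℝ :=
  Fin.snoc (fun j : Fin p => r j.castSucc) (max (-M) (min M (r (Fin.last p))))

@[simp] lemma clampBias_castSucc (M : ℝ) (r : Fin (p + 1) → ℝ) (j : Fin p) :
    clampBias M r j.castSucc = r j.castSucc := by
  simp [clampBias]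

@[simp] lemma clampBias_last (M : ℝ) (r : Fin (p + 1) → ℝ) :
    clampBias M r (Fin.last p) = max (-M) (min M (r (Fin.last p))) := by
  simp [clampBias]

lemma exists_clampBias_mem_learnerSet [Fintype V] (G : SimpleGraph V)
    (X : ∀ v : V, Fin (N v) → Fin (p + 1) → ℝ) {y : ∀ v : V, Fin (N v) → ℝ}
    (hy : ∀ v n, y v n = 1 ∨ y v n = -1) {W : ℝ} (hW : 0 ≤ W) :
    ∃ M, 0 ≤ M ∧ ∀ x ∈ learnerSet G X y, (∀ v, ∀ j : Fin p, |x.1 v j.castSucc| ≤ W) →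
      ((fun v => clampBias M (x.1 v)), x.2) ∈ learnerSet G X y := by
  set T : ∀ v : V, Fin (N v) → ℝ := fun v n =>
    (1 + ∑ j : Fin p, |X v n j.castSucc| * W) / |X v n (Fin.last p)| with hT
  have hT0 : ∀ v n, 0 ≤ T v n := fun v n => by positivity
  refine ⟨∑ v, ∑ n, T v n, sum_nonneg fun v _ => sum_nonneg fun n _ => hT0 v n,
    fun x hx hxW => ⟨fun v n => ?_, hx.2.1, fun v u h => ?_⟩⟩
  · have hTM : T v n ≤ ∑ v, ∑ n, T v n :=
      (single_le_sum (fun m _ => hT0 v m) (mem_univ n)).trans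
        (single_le_sum (f := fun v => ∑ n, T v n)
          (fun u _ => sum_nonneg fun m _ => hT0 u m) (mem_univ v))
    have habs : |y v n| = 1 := by rcases hy v n with h | h <;> simp [h]
    have h1 := hx.1 v n
    simp only [Fin.sum_univ_castSucc, clampBias_castSucc, clampBias_last, mul_add,
      ← mul_assoc] at h1 ⊢
    refine le_add_mul_clamp h1 (by linarith [hx.2.1 v n])
      (sum_nonneg fun v _ => sum_nonneg fun n _ => hT0 v n) (le_trans ?_ hTM)
    rw [abs_mul, abs_mul, habs, one_mul, one_mul, hT]
    refine div_le_div_of_nonneg_right (add_le_add_right ?_ 1) (abs_nonneg _)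
    refine (abs_sum_le_sum_abs _ _).trans (sum_le_sum fun j _ => ?_)
    rw [abs_mul]
    gcongr
    exact hxW v j
  · simp only [hx.2.2 v u h]

/-- Strategies which do no worse than the trivial one lie in a bounded set, up to the bias. -/
lemma bound_of_gameObjective_le [Fintype V] {Va : Finset V} {B A Ca : ℝ} (hB : 0 < B)
    {Cδ : V → ℝ}
    {x : (V → Fin (p + 1) → ℝ) × (∀ v : V, Fin (N v) → ℝ)} (hx : ∀ v n, 0 ≤ x.2 v n)
    {δ : {v : V // v ∈ Va} → Fin p → ℝ} (hδ : δ ∈ attackerSet Va p Cδ)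
    (hle : gameObjective Va B A Ca x δ ≤ gameObjective (N := N) Va B A Ca (0, fun _ _ => 1) δ) {Q : ℝ}
    (hQ : B * ∑ v : V, ∑ _n : Fin (N v), (1 : ℝ)
      + A ^ 2 * ∑ v : {v : V // v ∈ Va}, Cδ (v : V) ≤ Q) :
    (∀ v, ∀ j : Fin p, |x.1 v j.castSucc| ≤ 1 + 4 * Q) ∧ ∀ v n, x.2 v n ≤ Q / B := by
  have hpt : ∀ w d : ℝ, -(1 / 4 * w ^ 2) - A ^ 2 * d ^ 2 ≤ A * (w * d) := fun w d => by
    nlinarith [sq_nonneg (w / 2 + A * d)]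
  have hbil : -(1 / 4 * ∑ v : {v : V // v ∈ Va}, ∑ j : Fin p, (x.1 v j.castSucc) ^ 2)
        - A ^ 2 * ∑ v : {v : V // v ∈ Va}, ∑ j : Fin p, (δ v j) ^ 2
      ≤ ∑ v : {v : V // v ∈ Va}, A * ∑ j : Fin p, x.1 (v : V) j.castSucc * δ v j := by
    simp only [mul_sum, ← sum_neg_distrib, ← sum_sub_distrib]
    exact sum_le_sum fun v _ => sum_le_sum fun j _ => hpt _ _
  have hsub : ∑ v : {v : V // v ∈ Va}, ∑ j : Fin p, (x.1 v j.castSucc) ^ 2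
      ≤ ∑ v : V, ∑ j : Fin p, (x.1 v j.castSucc) ^ 2 := by
    rw [sum_coe_sort Va fun v => ∑ j : Fin p, (x.1 v j.castSucc) ^ 2]
    exact sum_le_sum_of_subset_of_nonneg (subset_univ _)
      fun v _ _ => sum_nonneg fun j _ => sq_nonneg _
  have hC : A ^ 2 * ∑ v : {v : V // v ∈ Va}, ∑ j : Fin p, (δ v j) ^ 2
      ≤ A ^ 2 * ∑ v : {v : V // v ∈ Va}, Cδ (v : V) :=
    mul_le_mul_of_nonneg_left (sum_le_sum fun v _ => hδ v) (sq_nonneg A)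
  have hw0 : 0 ≤ ∑ v : V, ∑ j : Fin p, (x.1 v j.castSucc) ^ 2 :=
    sum_nonneg fun v _ => sum_nonneg fun j _ => sq_nonneg _
  have hξ0 : 0 ≤ ∑ v : V, ∑ n : Fin (N v), x.2 v n :=
    sum_nonneg fun v _ => sum_nonneg fun n _ => hx v n
  have hBξ0 := mul_nonneg hB.le hξ0
  simp only [gameObjective, Pi.zero_apply, zero_mul, sum_const_zero, mul_zero, sum_sub_distrib,
    ne_eq, OfNat.ofNat_ne_zero, not_false_eq_true, zero_pow] at hle
  have hkey : 1 / 4 * ∑ v : V, ∑ j : Fin p, (x.1 v j.castSucc) ^ 2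
      + B * ∑ v : V, ∑ n : Fin (N v), x.2 v n ≤ Q := by linarith
  refine ⟨fun v j => ?_, fun v n => ?_⟩
  · have h1 : (x.1 v j.castSucc) ^ 2 ≤ ∑ v : V, ∑ j : Fin p, (x.1 v j.castSucc) ^ 2 :=
      (single_le_sum (f := fun j : Fin p => (x.1 v j.castSucc) ^ 2)
        (fun j _ => sq_nonneg _) (mem_univ j)).trans
        (single_le_sum (f := fun v => ∑ j : Fin p, (x.1 v j.castSucc) ^ 2)
          (fun u _ => sum_nonneg fun j _ => sq_nonneg _) (mem_univ v))
    exact abs_le_of_sq_le_sq (by nlinarith) (by linarith)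
  · have h1 : x.2 v n ≤ ∑ v : V, ∑ n : Fin (N v), x.2 v n :=
      (single_le_sum (fun m _ => hx v m) (mem_univ n)).trans
        (single_le_sum (f := fun v => ∑ n : Fin (N v), x.2 v n)
          (fun u _ => sum_nonneg fun m _ => hx u m) (mem_univ v))
    rw [le_div_iff₀ hB]
    nlinarith [mul_le_mul_of_nonneg_left h1 hB.le]

lemma mem_closedBall_zero_of_abs_le [Fintype V] {x : (V → Fin (p + 1) → ℝ) × (∀ v : V, Fin (N v) → ℝ)}
    {L : ℝ} (hL : 0 ≤ L) (hr : ∀ v i, |x.1 v i| ≤ L) (hξ : ∀ v n, |x.2 v n| ≤ L) :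
    x ∈ Metric.closedBall (0 : (V → Fin (p + 1) → ℝ) × (∀ v : V, Fin (N v) → ℝ)) L := by
  rw [mem_closedBall_zero_iff, Prod.norm_def, max_le_iff, pi_norm_le_iff_of_nonneg hL,
    pi_norm_le_iff_of_nonneg hL]
  exact ⟨fun v => (pi_norm_le_iff_of_nonneg hL).2 (hr v),
    fun v => (pi_norm_le_iff_of_nonneg hL).2 (hξ v)⟩

lemma exists_dominating_ball [Fintype V] (G : SimpleGraph V) (Va : Finset V)
    (X : ∀ v : V, Fin (N v) → Fin (p + 1) → ℝ) {y : ∀ v : V, Fin (N v) → ℝ}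
    (hy : ∀ v n, y v n = 1 ∨ y v n = -1) {Cδ : V → ℝ} (hCδ : ∀ v, 0 < Cδ v)
    {B : ℝ} (A Ca : ℝ) (hB : 0 < B) :
    ∃ L : ℝ, (learnerSet G X y ∩ Metric.closedBall 0 L).Nonempty ∧
      ∀ x ∈ learnerSet G X y, ∀ δ ∈ attackerSet Va p Cδ,
        ∃ x' ∈ learnerSet G X y ∩ Metric.closedBall 0 L,
          gameObjective Va B A Ca x' δ ≤ gameObjective Va B A Ca x δ := by
  set Q : ℝ := B * ∑ v : V, ∑ _n : Fin (N v), (1 : ℝ)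
      + A ^ 2 * ∑ v : {v : V // v ∈ Va}, Cδ (v : V) with hQ
  have hQ0 : 0 ≤ Q := add_nonneg
    (mul_nonneg hB.le (sum_nonneg fun v _ => sum_nonneg fun n _ => zero_le_one))
    (mul_nonneg (sq_nonneg A) (sum_nonneg fun v _ => (hCδ v).le))
  have hQB : 0 ≤ Q / B := div_nonneg hQ0 hB.le
  obtain ⟨M, hM0, hM⟩ :=
    exists_clampBias_mem_learnerSet G X hy (W := 1 + 4 * Q) (by linarith)
  have hL : 0 ≤ 1 + 4 * Q + Q / B + M := by linarith
  have hx₀ : ((0 : V → Fin (p + 1) → ℝ), fun (v : V) (_ : Fin (N v)) => (1 : ℝ)) ∈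
      learnerSet G X y ∩ Metric.closedBall 0 (1 + 4 * Q + Q / B + M) := by
    refine ⟨⟨fun v n => by simp, fun v n => zero_le_one, fun v u _ => rfl⟩,
      mem_closedBall_zero_of_abs_le hL (fun v i => ?_) (fun v n => ?_)⟩
    · simpa using hL
    · simp only [abs_one]; linarith
  refine ⟨_, ⟨_, hx₀⟩, fun x hx δ hδ => ?_⟩
  rcases le_total (gameObjective (N := N) Va B A Ca (0, fun _ _ => 1) δ)
      (gameObjective Va B A Ca x δ)
    with h | h
  · exact ⟨_, hx₀, h⟩
  obtain ⟨hw, hξ⟩ := bound_of_gameObjective_le hB hx.2.1 hδ h hQ.ge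
  refine ⟨_, ⟨hM x hx hw, mem_closedBall_zero_of_abs_le hL (fun v i => ?_) (fun v n => ?_)⟩, ?_⟩
  · refine Fin.lastCases ?_ (fun j => ?_) i
    · simp only [clampBias_last]
      have : |max (-M) (min M (x.1 v (Fin.last p)))| ≤ M :=
        abs_le.2 ⟨le_max_left _ _, max_le (by linarith) (min_le_left _ _)⟩
      linarith
    · simp only [clampBias_castSucc]
      linarith [hw v j]
  · rw [abs_of_nonneg (hx.2.1 v n)]
    linarith [hξ v n]
  · simp [gameObjective]

end Game

/-- Proposition 2: over the learner's feasible set `R` (SVM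
constraints plus consensus over the edges of a finite connected graph) and the
attacker's feasible set `D = ∏_{v∈V_a} U_{v0}`, the minimax value of `K'`
equals the maximin value, and a saddle point exists. -/
theorem minimax_eq_maximin_and_saddle_exists
    {V : Type*} [Fintype V] (G : SimpleGraph V) (hconn : G.Connected)
    (Va : Finset V) (p : ℕ) (hp : 1 ≤ p) (N : V → ℕ)
    (X : ∀ v : V, Fin (N v) → Fin (p + 1) → ℝ)
    (y : ∀ v : V, Fin (N v) → ℝ) (hy : ∀ v n, y v n = 1 ∨ y v n = -1)
    (Cδ : V → ℝ) (hCδ : ∀ v, 0 < Cδ v)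
    (B A Ca : ℝ) (hB : 0 < B) (hA : 0 < A) (hCa : 0 ≤ Ca)
    (K : ((V → Fin (p + 1) → ℝ) × (∀ v : V, Fin (N v) → ℝ)) →
          ({v : V // v ∈ Va} → Fin p → ℝ) → ℝ)
    (hK : ∀ rξ δ, K rξ δ =
        (1 / 2) * ∑ v : V, ∑ j : Fin p, (rξ.1 v j.castSucc) ^ 2
          + B * ∑ v : V, ∑ n : Fin (N v), rξ.2 v n
          + ∑ v : {v : V // v ∈ Va},
              (A * ∑ j : Fin p, rξ.1 (v : V) j.castSucc * δ v j
                - Ca * ∑ j : Fin p, |δ v j|))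
    (R : Set ((V → Fin (p + 1) → ℝ) × (∀ v : V, Fin (N v) → ℝ)))
    (hR : R = {rξ |
        (∀ (v : V) (n : Fin (N v)),
          1 - rξ.2 v n ≤ y v n * ∑ i : Fin (p + 1), X v n i * rξ.1 v i) ∧
        (∀ (v : V) (n : Fin (N v)), 0 ≤ rξ.2 v n) ∧
        (∀ v u : V, G.Adj v u → rξ.1 v = rξ.1 u)})
    (D : Set ({v : V // v ∈ Va} → Fin p → ℝ))
    (hD : D = {δ | ∀ v : {v : V // v ∈ Va}, ∑ j : Fin p, (δ v j) ^ 2 ≤ Cδ (v : V)}) :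
    sInf ((fun rξ => sSup ((fun δ => K rξ δ) '' D)) '' R)
      = sSup ((fun δ => sInf ((fun rξ => K rξ δ) '' R)) '' D) ∧
    ∃ rξstar ∈ R, ∃ δstar ∈ D,
      (∀ δ ∈ D, K rξstar δ ≤ K rξstar δstar) ∧
      (∀ rξ ∈ R, K rξstar δstar ≤ K rξ δstar) := by
  obtain rfl : K = gameObjective Va B A Ca := by
    funext x δ
    exact hK x δ
  change R = learnerSet G X y at hR
  change D = attackerSet Va p Cδ at hD
  subst hR hD
  obtain ⟨L, hne, hdom⟩ := exists_dominating_ball G Va X hy hCδ A Ca hB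
  exact minimax_of_dominating_compact Set.inter_subset_left hne
    ((isCompact_closedBall 0 L).inter_left (isClosed_learnerSet G X y))
    ((convex_learnerSet G X y).inter (convex_closedBall 0 L))
    (attackerSet_nonempty Va hCδ) (isCompact_attackerSet Va hCδ) (convex_attackerSet Va Cδ)
    (continuous_gameObjective_left Va B A Ca) (continuous_gameObjective_right Va B A Ca)
    (convexOn_gameObjective Va B A Ca) (concaveOn_gameObjective Va B A hCa) hdom
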